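/- arXiv:1904.02977 — 4 statements merged into one kernel-verified Lean document; each statement's English description precedes it below -/
import Mathlib

section
/- Let H be a complex Hilbert space and A : H → H a bounded linear operator. Then the surjectivity S-spectrum σ_suS(A) is a closed subset of ℍ, and the topological boundary ∂σ_S(A) of the S-spectrum (taken in ℍ) is contained in σ_suS(A). -/
open ContinuousLinearMap Set

/-- The pseudo-resolvent operator `R_q(A) = A² − 2 Re(q) A + |q|² I`. -/
noncomputable def pseudoRes {X : Type*} [NormedAddCommGroup X] [NormedSpace ℂ X]
    (A : X →L[ℂ] X) (q : Quaternion ℝ) : X →L[ℂ] X :=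
  A ∘L A - ((2 * q.re : ℝ) : ℂ) • A + ((‖q‖ ^ 2 : ℝ) : ℂ) • (1 : X →L[ℂ] X)

/-- The S-spectrum: quaternions `q` for which `R_q(A)` is not bijective. -/
def sigmaS {X : Type*} [NormedAddCommGroup X] [NormedSpace ℂ X]
    (A : X →L[ℂ] X) : Set (Quaternion ℝ) :=
  {q | ¬ Function.Bijective (pseudoRes A q)}

/-- The surjectivity S-spectrum: `R_q(A)` is not surjective. -/
def sigmaSuS {X : Type*} [NormedAddCommGroup X] [NormedSpace ℂ X]
    (A : X →L[ℂ] X) : Set (Quaternion ℝ) :=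
  {q | ¬ Function.Surjective (pseudoRes A q)}

theorem continuous_pseudoRes {X : Type*} [NormedAddCommGroup X] [NormedSpace ℂ X]
    (A : X →L[ℂ] X) : Continuous (pseudoRes A) := by
  have hre : Continuous fun q : Quaternion ℝ => q.re := Quaternion.continuous_re
  unfold pseudoRes
  fun_prop

/-- A surjective operator between Hilbert spaces has a bounded right inverse. -/
theorem exists_comp_eq_id_of_surjective {𝕜 E F : Type*} [RCLike 𝕜]
    [NormedAddCommGroup E] [InnerProductSpace 𝕜 E] [CompleteSpace E]
    [NormedAddCommGroup F] [NormedSpace 𝕜 F] [CompleteSpace F]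
    {T : E →L[𝕜] F} (hT : Function.Surjective T) :
    ∃ S : F →L[𝕜] E, T ∘L S = ContinuousLinearMap.id 𝕜 F := by
  have hclosed : IsClosed (T.ker : Set E) := T.isClosed_ker
  have : CompleteSpace T.ker := hclosed.completeSpace_coe
  let f : T.kerᗮ →L[𝕜] F := T ∘L T.kerᗮ.subtypeL
  have hker : f.ker = ⊥ := by
    refine (Submodule.eq_bot_iff _).2 fun x hx => ?_
    have hxT : (x : E) ∈ T.ker := hx
    exact Subtype.ext (inner_self_eq_zero.1 (x.2 x hxT))
  have hrange : f.range = ⊤ := by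
    refine LinearMap.range_eq_top.2 fun y => ?_
    obtain ⟨x, rfl⟩ := hT y
    obtain ⟨u, hu, v, hv, rfl⟩ := T.ker.exists_add_mem_mem_orthogonal x
    have hu0 : T u = 0 := hu
    exact ⟨⟨v, hv⟩, by simp [f, hu0]⟩
  let e := ContinuousLinearEquiv.ofBijective f hker hrange
  exact ⟨T.kerᗮ.subtypeL ∘L e.symm, ContinuousLinearMap.ext fun y => e.apply_symm_apply y⟩

/-- The right invertible elements of a complete normed ring form an open set. -/
theorem isOpen_setOf_exists_mul_eq_one {R : Type*} [NormedRing R] [HasSummableGeomSeries R] :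
    IsOpen {a : R | ∃ b, a * b = 1} := by
  refine isOpen_iff_mem_nhds.2 fun a ⟨b, hab⟩ => ?_
  have hopen : IsOpen {c : R | IsUnit (c * b)} := Units.isOpen.preimage (continuous_mul_const b)
  refine Filter.mem_of_superset (hopen.mem_nhds (by simp [hab])) fun c hc => ?_
  obtain ⟨d, hd⟩ := IsUnit.exists_right_inv hc
  exact ⟨b * d, by rw [← mul_assoc, hd]⟩

/-- A right invertible limit of units in a complete normed ring is a unit. -/
theorem isUnit_of_mem_closure_of_mul_eq_one {R : Type*} [NormedRing R]
    [HasSummableGeomSeries R] {a b : R} (ha : a ∈ closure {c : R | IsUnit c})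
    (hab : a * b = 1) : IsUnit a := by
  have hopen : IsOpen {c : R | IsUnit (c * b)} := Units.isOpen.preimage (continuous_mul_const b)
  obtain ⟨c, hcb, hc⟩ := mem_closure_iff.1 ha _ hopen (by simp [hab])
  obtain ⟨u, rfl⟩ := hc
  obtain ⟨v, rfl⟩ : IsUnit b := (Units.isUnit_units_mul u b).1 hcb
  exact ⟨v⁻¹, (Units.eq_inv_of_mul_eq_one_right hab).symm⟩

theorem ContinuousLinearMap.surjective_iff_exists_mul_eq_one {H : Type*} [NormedAddCommGroup H]
    [InnerProductSpace ℂ H] [CompleteSpace H] {T : H →L[ℂ] H} :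
    Function.Surjective T ↔ ∃ S, T * S = 1 :=
  ⟨exists_comp_eq_id_of_surjective, fun ⟨S, hS⟩ y => ⟨S y, DFunLike.congr_fun hS y⟩⟩

theorem sigmaSuS_closed_and_frontier_subset {H : Type*} [NormedAddCommGroup H]
    [InnerProductSpace ℂ H] [CompleteSpace H] (A : H →L[ℂ] H) :
    IsClosed (sigmaSuS A) ∧ frontier (sigmaS A) ⊆ sigmaSuS A := by
  have hcont := continuous_pseudoRes A
  have hcompl : (sigmaS A)ᶜ = pseudoRes A ⁻¹' {T | IsUnit T} := by
    ext q
    simp [sigmaS, isUnit_iff_bijective]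
  constructor
  · rw [← isOpen_compl_iff]
    convert isOpen_setOf_exists_mul_eq_one.preimage hcont using 1
    ext q
    simp [sigmaSuS, surjective_iff_exists_mul_eq_one]
  · intro q hq hsurj
    obtain ⟨S, hS⟩ := surjective_iff_exists_mul_eq_one.1 hsurj
    have hclosed : IsClosed (sigmaS A) := by
      rw [← isOpen_compl_iff, hcompl]
      exact Units.isOpen.preimage hcont
    rw [frontier_eq_closure_inter_closure, hclosed.closure_eq, hcompl] at hq
    have hunit := isUnit_of_mem_closure_of_mul_eq_one
      (hcont.closure_preimage_subset _ hq.2) hS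
    exact hq.1 (isUnit_iff_bijective.1 hunit)
end

section
/- Let X be a complex Banach space, A : X → X a bounded linear operator, and let M and N be closed A-invariant subspaces of X with X = M ⊕ N. Then: (a) σ_apS(A) = σ_apS(A|_M) ∪ σ_apS(A|_N); (b) σ_suS(A) = σ_suS(A|_M) ∪ σ_suS(A|_N); (c) σ_S(A) = σ_S(A|_M) ∪ σ_S(A|_N), where A|_M and A|_N denote the restrictions of A to M and N. -/
open ContinuousLinearMap Set

/-- An operator is bounded below if it is injective and has closed range. -/
def IsBoundedBelowOp {X : Type*} [NormedAddCommGroup X] [NormedSpace ℂ X]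
    (T : X →L[ℂ] X) : Prop :=
  Function.Injective T ∧ IsClosed (Set.range T)

/-- The approximate S-point spectrum: `R_q(A)` is not bounded below. -/
def sigmaApS {X : Type*} [NormedAddCommGroup X] [NormedSpace ℂ X]
    (A : X →L[ℂ] X) : Set (Quaternion ℝ) :=
  {q | ¬ IsBoundedBelowOp (pseudoRes A q)}

/-- Restriction of a continuous linear operator to an invariant submodule. -/
noncomputable def restrictOp {X : Type*} [NormedAddCommGroup X] [NormedSpace ℂ X]
    (A : X →L[ℂ] X) (M : Submodule ℂ X) (h : ∀ x ∈ M, A x ∈ M) : M →L[ℂ] M :=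
  { toLinearMap := (A : X →ₗ[ℂ] X).restrict h
    cont := (A.continuous.comp continuous_subtype_val).subtype_mk _ }

section DirectSum

variable {X : Type*} [NormedAddCommGroup X] [NormedSpace ℂ X]

theorem coe_pseudoRes_restrictOp (A : X →L[ℂ] X) (M : Submodule ℂ X) (h : ∀ x ∈ M, A x ∈ M)
    (q : Quaternion ℝ) (x : M) :
    (pseudoRes (restrictOp A M h) q x : X) = pseudoRes A q x := by
  rfl

theorem isClosed_prod_iff_of_nonempty {Y Z : Type*} [TopologicalSpace Y] [TopologicalSpace Z]
    {s : Set Y} {t : Set Z} (h : (s ×ˢ t).Nonempty) :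
    IsClosed (s ×ˢ t) ↔ IsClosed s ∧ IsClosed t := by
  rw [← closure_eq_iff_isClosed, closure_prod_eq,
    Set.prod_eq_prod_iff_of_nonempty (h.mono (Set.prod_mono subset_closure subset_closure)),
    closure_eq_iff_isClosed, closure_eq_iff_isClosed]

variable {M N : Submodule ℂ X}

/-- The topological direct sum decomposition conjugates `R_q(A)` to `R_q(A|_M) × R_q(A|_N)`. -/
theorem exists_homeomorph_conj_pseudoRes [CompleteSpace X] (A : X →L[ℂ] X)
    (hMc : IsClosed (M : Set X)) (hNc : IsClosed (N : Set X)) (hcompl : IsCompl M N)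
    (hM : ∀ x ∈ M, A x ∈ M) (hN : ∀ x ∈ N, A x ∈ N) :
    ∃ e : (M × N) ≃ₜ X, ∀ q, pseudoRes A q =
      e ∘ Prod.map (pseudoRes (restrictOp A M hM) q) (pseudoRes (restrictOp A N hN) q) ∘
        e.symm := by
  have hc := Submodule.IsCompl.isTopCompl_of_isClosed hcompl hMc hNc
  refine ⟨(M.prodEquivOfIsTopCompl N hc).toHomeomorph, fun q => ?_⟩
  rw [← Function.comp_assoc]
  refine (Homeomorph.toEquiv _).eq_comp_symm _ _ |>.2 ?_
  ext x
  simp [coe_pseudoRes_restrictOp]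

theorem isBoundedBelowOp_iff_of_conj {T : X →L[ℂ] X} {U : M →L[ℂ] M} {V : N →L[ℂ] N}
    (e : (M × N) ≃ₜ X) (h : T = e ∘ Prod.map U V ∘ e.symm) :
    IsBoundedBelowOp T ↔ IsBoundedBelowOp U ∧ IsBoundedBelowOp V := by
  have hr : Set.range T = e '' (Set.range U ×ˢ Set.range V) := by
    rw [h, Set.range_comp, e.symm.surjective.range_comp, Set.range_prodMap]
  have hi : Function.Injective T ↔ Function.Injective U ∧ Function.Injective V := by
    rw [h, EquivLike.comp_injective, EquivLike.injective_comp, Prod.map_injective]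
  rw [IsBoundedBelowOp, hr, hi, e.isClosed_image, isClosed_prod_iff_of_nonempty
    ((Set.range_nonempty _).prod (Set.range_nonempty _))]
  exact and_and_and_comm

end DirectSum

theorem spectra_of_direct_sum {X : Type*} [NormedAddCommGroup X] [NormedSpace ℂ X]
    [CompleteSpace X] (A : X →L[ℂ] X) (M N : Submodule ℂ X)
    (hMc : IsClosed (M : Set X)) (hNc : IsClosed (N : Set X)) (hcompl : IsCompl M N)
    (hM : ∀ x ∈ M, A x ∈ M) (hN : ∀ x ∈ N, A x ∈ N) :
    sigmaApS A = sigmaApS (restrictOp A M hM) ∪ sigmaApS (restrictOp A N hN) ∧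
    sigmaSuS A = sigmaSuS (restrictOp A M hM) ∪ sigmaSuS (restrictOp A N hN) ∧
    sigmaS A = sigmaS (restrictOp A M hM) ∪ sigmaS (restrictOp A N hN) := by
  obtain ⟨e, he⟩ := exists_homeomorph_conj_pseudoRes A hMc hNc hcompl hM hN
  refine ⟨?_, ?_, ?_⟩ <;> ext q
  · simp only [sigmaApS, mem_union, mem_ofPred_eq, isBoundedBelowOp_iff_of_conj e (he q),
      not_and_or]
  · simp only [sigmaSuS, mem_union, mem_ofPred_eq, he q, EquivLike.comp_surjective,
      EquivLike.surjective_comp, Prod.map_surjective, not_and_or]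
  · simp only [sigmaS, mem_union, mem_ofPred_eq, he q, EquivLike.comp_bijective,
      EquivLike.bijective_comp, Prod.map_bijective, not_and_or]
end

section
/- Let H be a nonzero complex Hilbert space and A : H → H a bounded linear operator. Then: (a) σ_apS(A) is contained in the spherical annulus {q ∈ ℍ : i(A) ≤ |q| ≤ r_S(A)}; (b) if A is not invertible, then the closed ball {q ∈ ℍ : |q| ≤ i(A)} is contained in σ_S(A); (c) if A is invertible, then the open ball {q ∈ ℍ : |q| < i(A)} is disjoint from σ_S(A). -/
open ContinuousLinearMap Set

/-- The lower bound `κ(A) = inf {‖Aφ‖ : ‖φ‖ = 1}`. -/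
noncomputable def kappaOp {X : Type*} [NormedAddCommGroup X] [NormedSpace ℂ X]
    (A : X →L[ℂ] X) : ℝ :=
  ⨅ φ : {φ : X // ‖φ‖ = 1}, ‖A φ.1‖

/-- `i(A) = sup_{n ≥ 1} κ(Aⁿ)^(1/n)` (which equals `lim κ(Aⁿ)^(1/n)`). -/
noncomputable def iOp {X : Type*} [NormedAddCommGroup X] [NormedSpace ℂ X]
    (A : X →L[ℂ] X) : ℝ :=
  ⨆ n : {n : ℕ // 1 ≤ n}, kappaOp (A ^ (n : ℕ)) ^ (((n : ℕ) : ℝ))⁻¹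

/-- The S-spectral radius `r_S(A) = lim ‖Aⁿ‖^(1/n) = inf_{n ≥ 1} ‖Aⁿ‖^(1/n)`. -/
noncomputable def rSOp {X : Type*} [NormedAddCommGroup X] [NormedSpace ℂ X]
    (A : X →L[ℂ] X) : ℝ :=
  ⨅ n : {n : ℕ // 1 ≤ n}, ‖A ^ (n : ℕ)‖ ^ (((n : ℕ) : ℝ))⁻¹

open scoped NNReal ComplexConjugate

theorem AntilipschitzWith.isBoundedBelowOp {X : Type*} [NormedAddCommGroup X] [NormedSpace ℂ X]
    [CompleteSpace X] {T : X →L[ℂ] X} {K : ℝ≥0} (hT : AntilipschitzWith K T) :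
    IsBoundedBelowOp T :=
  ⟨hT.injective, hT.isClosed_range T.uniformContinuous⟩

theorem kappaOp_mul_norm_le {X : Type*} [NormedAddCommGroup X] [NormedSpace ℂ X]
    (T : X →L[ℂ] X) (x : X) : kappaOp T * ‖x‖ ≤ ‖T x‖ := by
  rcases eq_or_ne x 0 with rfl | hx
  · simp
  have hx' : 0 < ‖x‖ := norm_pos_iff.2 hx
  have h1 : ‖((‖x‖⁻¹ : ℝ) : ℂ) • x‖ = 1 := by
    rw [norm_smul, Complex.norm_real, norm_inv, norm_norm, inv_mul_cancel₀ hx'.ne']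
  have h2 : kappaOp T ≤ ‖T (((‖x‖⁻¹ : ℝ) : ℂ) • x)‖ :=
    ciInf_le (f := fun φ : {φ : X // ‖φ‖ = 1} => ‖T φ.1‖)
      ⟨0, by rintro _ ⟨φ, rfl⟩; exact norm_nonneg _⟩ ⟨_, h1⟩
  rw [map_smul, norm_smul, Complex.norm_real, norm_inv, norm_norm, inv_mul_eq_div,
    le_div_iff₀ hx'] at h2
  exact h2

theorem kappaOp_nonneg {X : Type*} [NormedAddCommGroup X] [NormedSpace ℂ X]
    (T : X →L[ℂ] X) : 0 ≤ kappaOp T :=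
  Real.iInf_nonneg fun _ => norm_nonneg _

theorem exists_pow_lt_kappaOp_of_lt_iOp {X : Type*} [NormedAddCommGroup X] [NormedSpace ℂ X]
    {A : X →L[ℂ] X} {r : ℝ} (hr : 0 ≤ r) (h : r < iOp A) :
    ∃ n : ℕ, r ^ n < kappaOp (A ^ n) := by
  have : Nonempty {n : ℕ // 1 ≤ n} := ⟨⟨1, le_rfl⟩⟩
  obtain ⟨⟨n, hn⟩, hlt⟩ := exists_lt_of_lt_ciSup h
  refine ⟨n, ?_⟩
  rwa [Real.lt_rpow_inv_iff_of_pos hr (kappaOp_nonneg _) (by exact_mod_cast hn),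
    Real.rpow_natCast] at hlt

theorem exists_norm_pow_lt_of_rSOp_lt {X : Type*} [NormedAddCommGroup X] [NormedSpace ℂ X]
    {A : X →L[ℂ] X} {r : ℝ} (hr : 0 ≤ r) (h : rSOp A < r) :
    ∃ n : ℕ, ‖A ^ n‖ < r ^ n := by
  have : Nonempty {n : ℕ // 1 ≤ n} := ⟨⟨1, le_rfl⟩⟩
  obtain ⟨⟨n, hn⟩, hlt⟩ := exists_lt_of_ciInf_lt h
  refine ⟨n, ?_⟩
  rwa [Real.rpow_inv_lt_iff_of_pos (norm_nonneg _) hr (by exact_mod_cast hn),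
    Real.rpow_natCast] at hlt

/-- `z - A` is bounded below for `|z| < i(A)`. -/
theorem exists_antilipschitzWith_of_norm_lt_iOp {X : Type*} [NormedAddCommGroup X]
    [NormedSpace ℂ X] {A : X →L[ℂ] X} {z : ℂ} (hz : ‖z‖ < iOp A) :
    ∃ K, AntilipschitzWith K (algebraMap ℂ (X →L[ℂ] X) z - A) := by
  obtain ⟨n, hn⟩ := exists_pow_lt_kappaOp_of_lt_iOp (norm_nonneg z) hz
  set c := kappaOp (A ^ n) - ‖z‖ ^ n with hc
  have hc0 : 0 < c := sub_pos.2 hn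
  set B := algebraMap ℂ (X →L[ℂ] X) z - A with hB
  obtain ⟨S, hS⟩ : ∃ S : X →L[ℂ] X, S * B = algebraMap ℂ (X →L[ℂ] X) (z ^ n) - A ^ n :=
    ⟨_, by rw [map_pow]; exact (Algebra.commute_algebraMap_left z A).geom_sum₂_mul n⟩
  refine ⟨Real.toNNReal (c⁻¹ * ‖S‖), ContinuousLinearMap.antilipschitz_of_bound _ fun x => ?_⟩
  rw [Real.coe_toNNReal _ (by positivity), mul_assoc, ← div_eq_inv_mul, le_div_iff₀' hc0]
  have h1 : S (B x) = z ^ n • x - (A ^ n) x := by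
    rw [← mul_apply_eq_comp, hS, Algebra.algebraMap_eq_smul_one]
    simp
  have h2 : ‖(A ^ n) x‖ ≤ ‖z‖ ^ n * ‖x‖ + ‖S (B x)‖ := by
    have : (A ^ n) x = z ^ n • x - S (B x) := by rw [h1]; abel
    rw [this, ← norm_pow, ← norm_smul]
    exact norm_sub_le _ _
  have h3 := kappaOp_mul_norm_le (A ^ n) x
  have h4 := S.le_opNorm (B x)
  rw [hc, sub_mul]
  linarith

/-- A limit of points of the resolvent set at which `z - A` is bounded below is itself in the
resolvent set. -/
theorem mem_resolventSet_of_mem_closure {X : Type*} [NormedAddCommGroup X] [NormedSpace ℂ X]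
    [CompleteSpace X] {A : X →L[ℂ] X} {z : ℂ} (hz : z ∈ closure (resolventSet ℂ A)) {K : ℝ≥0}
    (hK : AntilipschitzWith K (algebraMap ℂ (X →L[ℂ] X) z - A)) : z ∈ resolventSet ℂ A := by
  rw [spectrum.mem_resolventSet_iff, ContinuousLinearMap.isUnit_iff_bijective]
  refine ⟨hK.injective, ?_⟩
  rw [← Set.range_eq_univ,
    ← (hK.isClosed_range (ContinuousLinearMap.uniformContinuous _)).closure_eq,
    Set.eq_univ_iff_forall]
  intro y
  refine Metric.mem_closure_iff.2 fun δ hδ => ?_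
  set D : ℝ := (2 * K + 1) * (1 + ‖y‖) with hD
  have hD0 : 0 < D := by positivity
  obtain ⟨w, hw, hzw⟩ := Metric.mem_closure_iff.1 hz (min 1 δ / D) (by positivity)
  rw [spectrum.mem_resolventSet_iff, ContinuousLinearMap.isUnit_iff_bijective] at hw
  obtain ⟨x, hx⟩ := hw.2 y
  set ε := dist z w with hε
  have hε0 : 0 ≤ ε := dist_nonneg
  rw [lt_div_iff₀ hD0, lt_min_iff] at hzw
  have hdiff : (algebraMap ℂ (X →L[ℂ] X) z - A) x - y = (z - w) • x := by
    rw [← hx]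
    simp [Algebra.algebraMap_eq_smul_one, sub_smul]
  have hn : ‖(algebraMap ℂ (X →L[ℂ] X) z - A) x - y‖ = ε * ‖x‖ := by
    rw [hdiff, norm_smul, hε, dist_eq_norm]
  have hK0 : (0 : ℝ) ≤ K := K.coe_nonneg
  have hxK : ‖x‖ ≤ K * ‖(algebraMap ℂ (X →L[ℂ] X) z - A) x‖ := by
    simpa using hK.le_mul_dist x 0
  have hT : ‖(algebraMap ℂ (X →L[ℂ] X) z - A) x‖ ≤ ε * ‖x‖ + ‖y‖ := by
    rw [← hn]
    exact norm_le_norm_sub_add _ _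
  have hy0 := norm_nonneg y
  have hsmall : K * ε ≤ 1 / 2 := by
    have h1 : 0 ≤ ε * (2 * K * ‖y‖ + 1 + ‖y‖) := by positivity
    rw [hD] at hzw
    nlinarith [hzw.1]
  have hxb : ‖x‖ ≤ 2 * K * ‖y‖ := by
    have h1 := mul_le_mul_of_nonneg_left hT hK0
    have h2 := mul_le_mul_of_nonneg_right hsmall (norm_nonneg x)
    linarith
  refine ⟨_, ⟨x, rfl⟩, ?_⟩
  rw [dist_comm, dist_eq_norm, hn]
  calc ε * ‖x‖ ≤ ε * (2 * K * ‖y‖) := by gcongr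
    _ ≤ ε * D := by
      gcongr
      rw [hD]
      nlinarith
    _ < δ := hzw.2

theorem zero_mem_resolventSet_iff_bijective {X : Type*} [NormedAddCommGroup X] [NormedSpace ℂ X]
    [CompleteSpace X] (A : X →L[ℂ] X) : (0 : ℂ) ∈ resolventSet ℂ A ↔ Function.Bijective A := by
  rw [spectrum.mem_resolventSet_iff, map_zero, zero_sub, IsUnit.neg_iff,
    ContinuousLinearMap.isUnit_iff_bijective]

/-- The disc `|z| < i(A)` meets the resolvent set only if it is contained in it. -/
theorem ball_iOp_subset_resolventSet {X : Type*} [NormedAddCommGroup X] [NormedSpace ℂ X]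
    [CompleteSpace X] {A : X →L[ℂ] X}
    (h : (Metric.ball (0 : ℂ) (iOp A) ∩ resolventSet ℂ A).Nonempty) :
    Metric.ball (0 : ℂ) (iOp A) ⊆ resolventSet ℂ A := by
  refine (convex_ball (0 : ℂ) (iOp A)).isPreconnected.subset_of_closure_inter_subset
    (spectrum.isOpen_resolventSet A) h ?_
  rintro z ⟨hz, hzb⟩
  obtain ⟨K, hK⟩ := exists_antilipschitzWith_of_norm_lt_iOp (mem_ball_zero_iff.1 hzb)
  exact mem_resolventSet_of_mem_closure hz hK

/-- If `A` is not invertible, the closed disc `|z| ≤ i(A)` consists of spectral points. -/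
theorem mem_spectrum_of_norm_le_iOp {X : Type*} [NormedAddCommGroup X] [NormedSpace ℂ X]
    [CompleteSpace X] {A : X →L[ℂ] X} (hA : ¬ Function.Bijective A) {z : ℂ}
    (hz : ‖z‖ ≤ iOp A) : z ∈ spectrum ℂ A := by
  have h0 : (0 : ℂ) ∉ resolventSet ℂ A := fun h =>
    hA ((zero_mem_resolventSet_iff_bijective A).1 h)
  rcases (norm_nonneg z |>.trans hz).eq_or_lt with hi | hi
  · obtain rfl : z = 0 := norm_le_zero_iff.1 (hi ▸ hz)
    exact h0
  have hball : Metric.ball (0 : ℂ) (iOp A) ⊆ spectrum ℂ A := fun w hw hwr =>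
    h0 (ball_iOp_subset_resolventSet ⟨w, hw, hwr⟩ (Metric.mem_ball_self hi))
  have := closure_minimal hball (spectrum.isClosed A)
  rw [closure_ball _ hi.ne'] at this
  exact this (mem_closedBall_zero_iff.2 hz)

/-- `R_q(A)` factors as `(z - A) (z̄ - A)` for a complex `z` in the sphere of `q`. -/
theorem exists_pseudoRes_eq_mul (q : Quaternion ℝ) :
    ∃ z : ℂ, ‖z‖ = ‖q‖ ∧ ∀ {X : Type*} [NormedAddCommGroup X] [NormedSpace ℂ X] (A : X →L[ℂ] X),
      pseudoRes A q =
        (algebraMap ℂ (X →L[ℂ] X) z - A) * (algebraMap ℂ (X →L[ℂ] X) (conj z) - A) := by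
  have hq : 0 ≤ ‖q‖ ^ 2 - q.re ^ 2 := by
    have h : ‖q‖ ^ 2 = q.re ^ 2 + q.imI ^ 2 + q.imJ ^ 2 + q.imK ^ 2 := by
      rw [sq, ← Quaternion.normSq_eq_norm_mul_self, Quaternion.normSq_def']
    rw [h]
    nlinarith [sq_nonneg q.imI, sq_nonneg q.imJ, sq_nonneg q.imK]
  have hn : Complex.normSq ⟨q.re, √(‖q‖ ^ 2 - q.re ^ 2)⟩ = ‖q‖ ^ 2 := by
    rw [Complex.normSq_mk, Real.mul_self_sqrt hq]
    ring
  refine ⟨⟨q.re, √(‖q‖ ^ 2 - q.re ^ 2)⟩, ?_, fun A => ?_⟩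
  · rw [Complex.norm_def, hn, Real.sqrt_sq (norm_nonneg q)]
  · set z : ℂ := ⟨q.re, √(‖q‖ ^ 2 - q.re ^ 2)⟩
    have hmul : z * conj z = ((‖q‖ ^ 2 : ℝ) : ℂ) := by rw [Complex.mul_conj, hn]
    have hadd : z + conj z = ((2 * q.re : ℝ) : ℂ) := Complex.add_conj z
    rw [pseudoRes, ← hmul, ← hadd]
    ext x
    simp only [Algebra.algebraMap_eq_smul_one, mul_apply_eq_comp, add_apply, sub_apply,
      smul_apply, one_apply_eq_self, comp_apply, map_sub, map_smul]
    module

theorem sigmaApS_annulus_and_balls {H : Type*} [NormedAddCommGroup H]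
    [InnerProductSpace ℂ H] [CompleteSpace H] [Nontrivial H] (A : H →L[ℂ] H) :
    sigmaApS A ⊆ {q : Quaternion ℝ | iOp A ≤ ‖q‖ ∧ ‖q‖ ≤ rSOp A} ∧
    (¬ Function.Bijective A → {q : Quaternion ℝ | ‖q‖ ≤ iOp A} ⊆ sigmaS A) ∧
    (Function.Bijective A → ∀ q : Quaternion ℝ, ‖q‖ < iOp A → q ∉ sigmaS A) := by
  have hbij : ∀ (q : Quaternion ℝ) (z : ℂ), pseudoRes A q =
      (algebraMap ℂ (H →L[ℂ] H) z - A) * (algebraMap ℂ (H →L[ℂ] H) (conj z) - A) →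
      (Function.Bijective (pseudoRes A q) ↔
        z ∈ resolventSet ℂ A ∧ conj z ∈ resolventSet ℂ A) := by
    intro q z hf
    have hcomm : Commute (algebraMap ℂ (H →L[ℂ] H) z - A)
        (algebraMap ℂ (H →L[ℂ] H) (conj z) - A) :=
      (Algebra.commute_algebraMap_left z _).sub_left
        ((Algebra.commute_algebraMap_right (conj z) A).sub_right (Commute.refl A))
    rw [← ContinuousLinearMap.isUnit_iff_bijective, hf, hcomm.isUnit_mul_iff]
    rfl
  refine ⟨fun q hq => ⟨?_, ?_⟩, fun hA q hq hb => ?_, fun hA q hq hs => ?_⟩ <;>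
    obtain ⟨z, hz, hf⟩ := exists_pseudoRes_eq_mul q <;>
    specialize hf A
  · by_contra! hlt
    obtain ⟨K, hK⟩ := exists_antilipschitzWith_of_norm_lt_iOp (hz.trans_lt hlt)
    obtain ⟨L, hL⟩ := exists_antilipschitzWith_of_norm_lt_iOp
      (((Complex.norm_conj z).trans hz).trans_lt hlt)
    refine hq (AntilipschitzWith.isBoundedBelowOp (K := L * K) ?_)
    rw [hf]
    exact hK.comp hL
  · by_contra! hlt
    obtain ⟨n, hn⟩ := exists_norm_pow_lt_of_rSOp_lt (norm_nonneg q) hlt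
    have hres : ∀ w : ℂ, ‖w‖ = ‖q‖ → w ∈ resolventSet ℂ A := fun w hw => by
      by_contra hws
      refine spectrum.pow_mem_pow A n hws (spectrum.mem_resolventSet_of_norm_lt ?_)
      rwa [norm_pow w, hw]
    have hb := (hbij q z hf).2 ⟨hres z hz, hres _ ((Complex.norm_conj z).trans hz)⟩
    exact hq ⟨hb.1, by rw [hb.2.range_eq]; exact isClosed_univ⟩
  · exact mem_spectrum_of_norm_le_iOp hA (hz.trans_le hq) ((hbij q z hf).1 hb).1
  · have hi : 0 < iOp A := (norm_nonneg q).trans_lt hq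
    have hsub := ball_iOp_subset_resolventSet
      ⟨0, Metric.mem_ball_self hi, (zero_mem_resolventSet_iff_bijective A).2 hA⟩
    refine hs ((hbij q z hf).2 ⟨hsub ?_, hsub ?_⟩) <;> rw [mem_ball_zero_iff]
    · rwa [hz]
    · rwa [Complex.norm_conj, hz]
end

section
/- Let X be a complex Banach space and A : X → X a bounded linear operator. (a) If F is a closed linear subspace of X such that A(F) = F, then F ⊆ K(A), the analytic core of A. (b) If the algebraic core C(A) is closed, then C(A) = K(A). -/
open ContinuousLinearMap Set

/-- The algebraic core `C(A)`. -/
def algebraicCore {X : Type*} [NormedAddCommGroup X] [NormedSpace ℂ X]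
    (A : X →L[ℂ] X) : Set X :=
  {φ | ∃ ψ : ℕ → X, ψ 0 = φ ∧ ∀ n : ℕ, A (ψ (n + 1)) = ψ n}

/-- The analytic core `K(A)`. -/
def analyticCore {X : Type*} [NormedAddCommGroup X] [NormedSpace ℂ X]
    (A : X →L[ℂ] X) : Set X :=
  {φ | ∃ (u : ℕ → X) (δ : ℝ), 0 < δ ∧ u 0 = φ ∧ (∀ n : ℕ, A (u (n + 1)) = u n) ∧
    ∀ n : ℕ, ‖u n‖ ≤ δ ^ n * ‖φ‖}

/-- A closed subspace mapped onto itself by `A` lies in the analytic core of `A`. -/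
theorem subset_analyticCore_of_image_eq {X : Type*} [NormedAddCommGroup X]
    [NormedSpace ℂ X] [CompleteSpace X] (A : X →L[ℂ] X) (F : Submodule ℂ X)
    (hF : IsClosed (F : Set X)) (hAF : A '' (F : Set X) = (F : Set X)) :
    (F : Set X) ⊆ analyticCore A := by
  have : CompleteSpace F := hF.completeSpace_coe
  have hmaps : ∀ x ∈ F, A x ∈ F := fun x hx => hAF.subset (mem_image_of_mem A hx)
  let B : F →L[ℂ] F := (A.comp F.subtypeL).codRestrict F fun x => hmaps x x.2
  have hB : Function.Surjective B := by
    rintro ⟨y, hy⟩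
    obtain ⟨x, hx, hxy⟩ := hAF.superset hy
    exact ⟨⟨x, hx⟩, Subtype.ext hxy⟩
  obtain ⟨C, hC, h⟩ := B.exists_preimage_norm_le hB
  choose g hg hgC using h
  intro φ hφ
  refine ⟨fun n => (g^[n] ⟨φ, hφ⟩ : F), C, hC, rfl, fun n => ?_, fun n => ?_⟩
  · beta_reduce
    rw [Function.iterate_succ_apply']
    exact congrArg Subtype.val (hg (g^[n] ⟨φ, hφ⟩))
  · induction n with
    | zero => simp
    | succ n ih =>
      beta_reduce
      rw [Function.iterate_succ_apply', pow_succ', mul_assoc]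
      exact (hgC _).trans (mul_le_mul_of_nonneg_left ih hC.le)

/-- The algebraic core as a linear subspace. -/
def algebraicCoreSubmodule {X : Type*} [NormedAddCommGroup X] [NormedSpace ℂ X]
    (A : X →L[ℂ] X) : Submodule ℂ X where
  carrier := algebraicCore A
  zero_mem' := ⟨0, rfl, fun _ => map_zero A⟩
  add_mem' := by
    rintro _ _ ⟨ψ, rfl, hψ⟩ ⟨χ, rfl, hχ⟩
    exact ⟨ψ + χ, rfl, fun n => by simp [hψ, hχ]⟩
  smul_mem' := by
    rintro c _ ⟨ψ, rfl, hψ⟩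
    exact ⟨c • ψ, rfl, fun n => by simp [hψ]⟩

theorem image_algebraicCore {X : Type*} [NormedAddCommGroup X] [NormedSpace ℂ X]
    (A : X →L[ℂ] X) : A '' algebraicCore A = algebraicCore A := by
  ext φ
  constructor
  · rintro ⟨_, ⟨ψ, rfl, hψ⟩, rfl⟩
    exact ⟨fun n => A (ψ n), rfl, fun n => congrArg A (hψ n)⟩
  · rintro ⟨ψ, rfl, hψ⟩
    exact ⟨ψ 1, ⟨fun n => ψ (n + 1), rfl, fun n => hψ (n + 1)⟩, hψ 0⟩

theorem analyticCore_subset_algebraicCore {X : Type*} [NormedAddCommGroup X]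
    [NormedSpace ℂ X] (A : X →L[ℂ] X) : analyticCore A ⊆ algebraicCore A :=
  fun _ ⟨u, _, _, hu, hA, _⟩ => ⟨u, hu, hA⟩

theorem analyticCore_contains_invariant {X : Type*} [NormedAddCommGroup X]
    [NormedSpace ℂ X] [CompleteSpace X] (A : X →L[ℂ] X) :
    (∀ F : Submodule ℂ X, IsClosed (F : Set X) → A '' (F : Set X) = (F : Set X) →
      (F : Set X) ⊆ analyticCore A) ∧
    (IsClosed (algebraicCore A) → algebraicCore A = analyticCore A) := by
  exact ⟨subset_analyticCore_of_image_eq A, fun hC =>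
    (subset_analyticCore_of_image_eq A (algebraicCoreSubmodule A) hC
      (image_algebraicCore A)).antisymm (analyticCore_subset_algebraicCore A)⟩
end
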